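/- Let (X, T) and (Y, S) be dynamical systems with metrics d on X and d' on Y, and let π : (X, T) → (Y, S) be an equivariant continuous map. Fix ε > 0 and δ > 0. Then the sequence a_N := sup_{y∈Y} log #(π^{-1}(B_δ(y, d'_N)), d_N, ε) is subadditive in N: for all natural numbers N_1, N_2, one has a_{N_1+N_2} ≤ a_{N_1} + a_{N_2}. Here B_δ(y, d'_N) = {x ∈ Y : d'_N(x, y) ≤ δ}. -/

import Mathlib

open Filter Topology
open scoped ENNReal NNReal

noncomputable section

/-- Diameter (in `ℝ≥0∞`) of a set with respect to a distance function `ρ`. -/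
def setEDiam {X : Type*} (ρ : X → X → ℝ) (E : Set X) : ℝ≥0∞ :=
  ⨆ x ∈ E, ⨆ y ∈ E, ENNReal.ofReal (ρ x y)

/-- Openness with respect to a distance function `ρ`. -/
def ROpen {X : Type*} (ρ : X → X → ℝ) (U : Set X) : Prop :=
  ∀ x ∈ U, ∃ δ > 0, ∀ y, ρ x y < δ → y ∈ U

/-- `#(E, ρ, ε)`: the minimal number `n` of `ρ`-open sets of `ρ`-diameter `< ε` covering `E`
(`0` when `E = ∅`, since the empty family covers it). -/
def covNum {X : Type*} (ρ : X → X → ℝ) (ε : ℝ) (E : Set X) : ℕ :=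
  sInf {n : ℕ | ∃ U : Fin n → Set X, (∀ i, ROpen ρ (U i)) ∧
    (∀ i, setEDiam ρ (U i) < ENNReal.ofReal ε) ∧ E ⊆ ⋃ i, U i}

/-- The dynamical metric `d_N(x,y) = max_{0 ≤ n < N} d(Tⁿx, Tⁿy)`. -/
def dynDist {X : Type*} (T : X → X) (d : X → X → ℝ) (N : ℕ) (x y : X) : ℝ :=
  sSup {r : ℝ | ∃ n, n < N ∧ r = d (T^[n] x) (T^[n] y)}

/-- `sup_{y ∈ Y} log #(π⁻¹(y), ρ, ε)`. -/
def supLogCov {X Y : Type*} (π : X → Y) (ρ : X → X → ℝ) (ε : ℝ) : ℝ :=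
  ⨆ y : Y, Real.log (covNum ρ ε (π ⁻¹' {y}) : ℝ)

/-- `sup_{y ∈ Y} log #(π⁻¹(B_δ(y, ρY)), ρX, ε)` where `B_δ` is the closed `δ`-ball. -/
def supLogCovBall {X Y : Type*} (π : X → Y) (ρX : X → X → ℝ) (ρY : Y → Y → ℝ)
    (ε δ : ℝ) : ℝ :=
  ⨆ y : Y, Real.log (covNum ρX ε (π ⁻¹' {x | ρY x y ≤ δ}) : ℝ)

/-- Topological conditional entropy
`h_top(π, T) = lim_{ε→0} lim_{N→∞} (sup_y log #(π⁻¹(y), d_N, ε))/N`, as an extended real. -/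
def condEntropy {X Y : Type*} (π : X → Y) (T : X → X) (d : X → X → ℝ) : EReal :=
  Filter.limsup (fun ε : ℝ => Filter.liminf
      (fun N : ℕ => ((supLogCov π (dynDist T d N) ε / N : ℝ) : EReal)) Filter.atTop)
    (𝓝[>] (0 : ℝ))

/-- `lim_{N→∞} (sup_y log #(π⁻¹(y), d_N, ε))/(N log(1/ε))` (the limit exists by
subadditivity; it is realized here as a liminf). -/
def condMdimRate {X Y : Type*} (π : X → Y) (T : X → X) (d : X → X → ℝ) (ε : ℝ) : EReal :=
  Filter.liminf (fun N : ℕ =>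
    ((supLogCov π (dynDist T d N) ε / (N * Real.log (1 / ε)) : ℝ) : EReal)) Filter.atTop

/-- Lower conditional metric mean dimension of `π : (X,T,d) → Y`. -/
def lowerCondMdimM {X Y : Type*} (π : X → Y) (T : X → X) (d : X → X → ℝ) : EReal :=
  Filter.liminf (fun ε : ℝ => condMdimRate π T d ε) (𝓝[>] (0 : ℝ))

/-- Upper conditional metric mean dimension of `π : (X,T,d) → Y`. -/
def upperCondMdimM {X Y : Type*} (π : X → Y) (T : X → X) (d : X → X → ℝ) : EReal :=
  Filter.limsup (fun ε : ℝ => condMdimRate π T d ε) (𝓝[>] (0 : ℝ))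

/-- `lim_{N→∞} log #(X, d_N, ε)/(N log(1/ε))`. -/
def mdimMRate {X : Type*} (T : X → X) (d : X → X → ℝ) (ε : ℝ) : EReal :=
  Filter.liminf (fun N : ℕ =>
    ((Real.log (covNum (dynDist T d N) ε (Set.univ : Set X) : ℝ) /
      (N * Real.log (1 / ε)) : ℝ) : EReal)) Filter.atTop

/-- Lower metric mean dimension of `(X, T, d)`. -/
def lowerMdimM {X : Type*} (T : X → X) (d : X → X → ℝ) : EReal :=
  Filter.liminf (fun ε : ℝ => mdimMRate T d ε) (𝓝[>] (0 : ℝ))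

/-- Upper metric mean dimension of `(X, T, d)`. -/
def upperMdimM {X : Type*} (T : X → X) (d : X → X → ℝ) : EReal :=
  Filter.limsup (fun ε : ℝ => mdimMRate T d ε) (𝓝[>] (0 : ℝ))

/-- `widim_ε(X, ρ)`: the minimal `k` such that there are a finite simplicial complex of
dimension `≤ k` (realized in some `ℝ^m`) and a continuous `ε`-embedding `f : X → P`
(all fibers of `f` have `ρ`-diameter `< ε`). -/
def widim (X : Type*) [TopologicalSpace X] (ρ : X → X → ℝ) (ε : ℝ) : ℕ :=
  sInf {k : ℕ | ∃ (m : ℕ) (K : Geometry.SimplicialComplex ℝ (Fin m → ℝ)),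
    K.faces.Finite ∧ (∀ s ∈ K.faces, s.card ≤ k + 1) ∧
    ∃ f : X → K.space, Continuous f ∧
      ∀ p : K.space, setEDiam ρ (f ⁻¹' {p}) < ENNReal.ofReal ε}

/-- Mean dimension `mdim(X, T) = lim_{ε→0} lim_{N→∞} widim_ε(X, d_N)/N`. -/
def mdim (X : Type*) [TopologicalSpace X] (T : X → X) (d : X → X → ℝ) : EReal :=
  Filter.limsup (fun ε : ℝ => Filter.liminf
      (fun N : ℕ => (((widim X (dynDist T d N) ε : ℝ) / N : ℝ) : EReal)) Filter.atTop)
    (𝓝[>] (0 : ℝ))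

/-- The cube `[0,1]^a`. -/
abbrev Cube (a : ℕ) := Fin a → unitInterval

/-- The full shift space `([0,1]^a)^ℤ`. -/
abbrev FullShift (a : ℕ) := ℤ → Cube a

/-- The shift map `σ((x_n)_n) = (x_{n+1})_n`. -/
def shift {α : Type*} (x : ℤ → α) : ℤ → α := fun n => x (n + 1)

/-- The `ℓ^∞`-distance on the cube `[0,1]^a`. -/
def cubeDist {a : ℕ} (x y : Cube a) : ℝ :=
  ‖(fun i => (x i : ℝ)) - fun i => (y i : ℝ)‖

/-- The metric `D((x_n), (y_n)) = Σ_{n∈ℤ} 2^{-|n|} ‖x_n − y_n‖_∞` on the full shift. -/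
def shiftDist {a : ℕ} (x y : FullShift a) : ℝ :=
  ∑' n : ℤ, (2 : ℝ) ^ (-|n|) * cubeDist (x n) (y n)

end

section DynamicalMetric

variable {X : Type*} [MetricSpace X] (T : X → X)

lemma dist_iterate_le_dynDist {N n : ℕ} (h : n < N) (x y : X) :
    dist (T^[n] x) (T^[n] y) ≤ dynDist T dist N x y := by
  refine le_csSup (Set.Finite.bddAbove ?_) ⟨n, h, rfl⟩
  refine ((Set.finite_lt_nat N).image fun n => dist (T^[n] x) (T^[n] y)).subset ?_
  rintro r ⟨n, hn, rfl⟩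
  exact ⟨n, hn, rfl⟩

lemma dynDist_le {N : ℕ} {x y : X} {c : ℝ} (hc : 0 ≤ c)
    (h : ∀ n < N, dist (T^[n] x) (T^[n] y) ≤ c) : dynDist T dist N x y ≤ c := by
  refine Real.sSup_le ?_ hc
  rintro r ⟨n, hn, rfl⟩
  exact h n hn

lemma dynDist_nonneg (N : ℕ) (x y : X) : 0 ≤ dynDist T dist N x y := by
  refine Real.sSup_nonneg ?_
  rintro r ⟨n, -, rfl⟩
  exact dist_nonneg

lemma dynDist_le_add (M N : ℕ) (x y : X) :
    dynDist T dist M x y ≤ dynDist T dist (M + N) x y :=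
  dynDist_le T (dynDist_nonneg T _ x y) fun _ hn =>
    dist_iterate_le_dynDist T (Nat.lt_add_right N hn) x y

lemma dynDist_iterate_le_add (M N : ℕ) (x y : X) :
    dynDist T dist N (T^[M] x) (T^[M] y) ≤ dynDist T dist (M + N) x y := by
  refine dynDist_le T (dynDist_nonneg T _ x y) fun n hn => ?_
  rw [← Function.iterate_add_apply, ← Function.iterate_add_apply]
  exact dist_iterate_le_dynDist T (by omega) x y

lemma dynDist_add_le_max (M N : ℕ) (x y : X) :
    dynDist T dist (M + N) x y ≤
      max (dynDist T dist M x y) (dynDist T dist N (T^[M] x) (T^[M] y)) := by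
  refine dynDist_le T (le_max_of_le_left (dynDist_nonneg T _ x y)) fun n hn => ?_
  rcases lt_or_ge n M with h | h
  · exact le_max_of_le_left (dist_iterate_le_dynDist T h x y)
  · refine le_max_of_le_right ?_
    have := dist_iterate_le_dynDist T (show n - M < N by omega) (T^[M] x) (T^[M] y)
    rwa [← Function.iterate_add_apply, ← Function.iterate_add_apply,
      Nat.sub_add_cancel h] at this

end DynamicalMetric

/-- `E` is covered by `n` many `ρ`-open sets of `ρ`-diameter less than `ε`. -/
def HasOpenCover {X : Type*} (ρ : X → X → ℝ) (ε : ℝ) (E : Set X) (n : ℕ) : Prop :=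
  ∃ U : Fin n → Set X, (∀ i, ROpen ρ (U i)) ∧
    (∀ i, setEDiam ρ (U i) < ENNReal.ofReal ε) ∧ E ⊆ ⋃ i, U i

section Covers

variable {X : Type*} {ρ : X → X → ℝ} {ε : ℝ} {E F : Set X} {m n : ℕ}

lemma HasOpenCover.mono (h : HasOpenCover ρ ε F n) (hEF : E ⊆ F) : HasOpenCover ρ ε E n :=
  let ⟨U, hU, hd, hc⟩ := h
  ⟨U, hU, hd, hEF.trans hc⟩

lemma HasOpenCover.covNum_le (h : HasOpenCover ρ ε E n) : covNum ρ ε E ≤ n :=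
  Nat.sInf_le h

lemma HasOpenCover.covNum (h : HasOpenCover ρ ε E n) : HasOpenCover ρ ε E (covNum ρ ε E) :=
  Nat.sInf_mem (s := {n | HasOpenCover ρ ε E n}) ⟨n, h⟩

lemma HasOpenCover.pos (h : HasOpenCover ρ ε E n) (hE : E.Nonempty) : 0 < n := by
  obtain ⟨U, -, -, hc⟩ := h
  obtain ⟨x, hx⟩ := hE
  obtain ⟨i, -⟩ := Set.mem_iUnion.1 (hc hx)
  exact i.pos

lemma covNum_empty : covNum ρ ε (∅ : Set X) = 0 :=
  Nat.le_zero.1 <| HasOpenCover.covNum_le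
    ⟨fun _ => ∅, fun i => i.elim0, fun i => i.elim0, Set.empty_subset _⟩

lemma log_covNum_nonneg : 0 ≤ Real.log (covNum ρ ε E : ℝ) :=
  Real.log_natCast_nonneg _

lemma ofReal_le_setEDiam {x y : X} (hx : x ∈ E) (hy : y ∈ E) :
    ENNReal.ofReal (ρ x y) ≤ setEDiam ρ E :=
  (le_iSup₂ (f := fun y (_ : y ∈ E) => ENNReal.ofReal (ρ x y)) y hy).trans
    (le_iSup₂ (f := fun x (_ : x ∈ E) => ⨆ y ∈ E, ENNReal.ofReal (ρ x y)) x hx)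

variable [MetricSpace X] {T : X → X}

lemma ROpen.inter_preimage_iterate {M N : ℕ} {U V : Set X} (hU : ROpen (dynDist T dist M) U)
    (hV : ROpen (dynDist T dist N) V) : ROpen (dynDist T dist (M + N)) (U ∩ T^[M] ⁻¹' V) := by
  rintro x ⟨hxU, hxV⟩
  obtain ⟨a, ha, hUa⟩ := hU x hxU
  obtain ⟨b, hb, hVb⟩ := hV _ hxV
  refine ⟨min a b, lt_min ha hb, fun y hy => ⟨hUa y ?_, hVb _ ?_⟩⟩
  · exact (dynDist_le_add T M N x y).trans_lt (hy.trans_le (min_le_left _ _))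
  · exact (dynDist_iterate_le_add T M N x y).trans_lt (hy.trans_le (min_le_right _ _))

lemma setEDiam_inter_preimage_iterate_le (M N : ℕ) (U V : Set X) :
    setEDiam (dynDist T dist (M + N)) (U ∩ T^[M] ⁻¹' V) ≤
      max (setEDiam (dynDist T dist M) U) (setEDiam (dynDist T dist N) V) := by
  refine iSup₂_le fun x hx => iSup₂_le fun y hy => ?_
  refine (ENNReal.ofReal_le_ofReal (dynDist_add_le_max T M N x y)).trans ?_
  rw [ENNReal.ofReal_max]
  exact max_le_max (ofReal_le_setEDiam hx.1 hy.1) (ofReal_le_setEDiam hx.2 hy.2)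

lemma HasOpenCover.inter_preimage_iterate {M N : ℕ}
    (hE : HasOpenCover (dynDist T dist M) ε E m) (hF : HasOpenCover (dynDist T dist N) ε F n) :
    HasOpenCover (dynDist T dist (M + N)) ε (E ∩ T^[M] ⁻¹' F) (m * n) := by
  obtain ⟨U, hU, hUd, hUc⟩ := hE
  obtain ⟨V, hV, hVd, hVc⟩ := hF
  refine ⟨fun k => U (finProdFinEquiv.symm k).1 ∩ T^[M] ⁻¹' V (finProdFinEquiv.symm k).2,
    fun k => (hU _).inter_preimage_iterate (hV _), fun k =>
    (setEDiam_inter_preimage_iterate_le M N _ _).trans_lt (max_lt (hUd _) (hVd _)), ?_⟩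
  rintro x ⟨hxE, hxF⟩
  obtain ⟨i, hi⟩ := Set.mem_iUnion.1 (hUc hxE)
  obtain ⟨j, hj⟩ := Set.mem_iUnion.1 (hVc hxF)
  exact Set.mem_iUnion.2 ⟨finProdFinEquiv (i, j), by simpa using ⟨hi, hj⟩⟩

lemma dynDist_zero (x y : X) : dynDist T dist 0 x y = 0 :=
  le_antisymm (dynDist_le T le_rfl fun n hn => absurd hn n.not_lt_zero) (dynDist_nonneg T 0 x y)

lemma dynDist_one (x y : X) : dynDist T dist 1 x y = dist x y := by
  refine le_antisymm (dynDist_le T dist_nonneg fun n hn => ?_)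
    (dist_iterate_le_dynDist T one_pos x y)
  simp [Nat.lt_one_iff.1 hn]

lemma exists_hasOpenCover_univ_dynDist_one [CompactSpace X] (hε : 0 < ε) :
    ∃ n, HasOpenCover (dynDist T dist 1) ε (Set.univ : Set X) n := by
  obtain ⟨t, -, ht, hc⟩ := finite_cover_balls_of_compact (isCompact_univ (X := X))
    (show 0 < ε / 3 by positivity)
  obtain ⟨n, ⟨e⟩⟩ := ht.exists_equiv_fin
  refine ⟨n, fun i => Metric.ball (e.symm i : X) (ε / 3), fun i x hx => ?_, fun i => ?_, ?_⟩
  · obtain ⟨r, hr, h⟩ := Metric.isOpen_iff.1 Metric.isOpen_ball x hx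
    refine ⟨r, hr, fun y hy => h ?_⟩
    rwa [dynDist_one, dist_comm] at hy
  · refine lt_of_le_of_lt (b := ENNReal.ofReal (2 * (ε / 3))) ?_
      ((ENNReal.ofReal_lt_ofReal_iff hε).2 (by linarith))
    refine iSup₂_le fun x hx => iSup₂_le fun y hy => ENNReal.ofReal_le_ofReal ?_
    rw [dynDist_one]
    linarith [dist_triangle_right x y (e.symm i : X), Metric.mem_ball.1 hx, Metric.mem_ball.1 hy]
  · intro x hx
    obtain ⟨z, hz, hxz⟩ := Set.mem_iUnion₂.1 (hc hx)
    exact Set.mem_iUnion.2 ⟨e ⟨z, hz⟩, by simpa using hxz⟩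

lemma exists_hasOpenCover_univ_dynDist [CompactSpace X] (hε : 0 < ε) (N : ℕ) :
    ∃ n, HasOpenCover (dynDist T dist N) ε (Set.univ : Set X) n := by
  induction N with
  | zero =>
    refine ⟨1, fun _ => Set.univ, fun _ x _ => ⟨1, one_pos, fun _ _ => Set.mem_univ _⟩,
      fun _ => ?_, fun x _ => Set.mem_iUnion.2 ⟨0, Set.mem_univ x⟩⟩
    simpa [setEDiam, dynDist_zero] using hε
  | succ N ih =>
    obtain ⟨m, hm⟩ := ih
    obtain ⟨n, hn⟩ := exists_hasOpenCover_univ_dynDist_one (T := T) hε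
    exact ⟨m * n, by simpa using hm.inter_preimage_iterate hn⟩

lemma hasOpenCover_covNum_dynDist [CompactSpace X] (hε : 0 < ε) (N : ℕ) (E : Set X) :
    HasOpenCover (dynDist T dist N) ε E (covNum (dynDist T dist N) ε E) :=
  let ⟨_, h⟩ := exists_hasOpenCover_univ_dynDist hε N
  (h.mono (Set.subset_univ E)).covNum

lemma log_covNum_le_of_subset_inter_preimage_iterate [CompactSpace X] (hε : 0 < ε) {M N : ℕ}
    {G : Set X} (hG : G ⊆ E ∩ T^[M] ⁻¹' F) :
    Real.log (covNum (dynDist T dist (M + N)) ε G : ℝ) ≤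
      Real.log (covNum (dynDist T dist M) ε E : ℝ) +
        Real.log (covNum (dynDist T dist N) ε F : ℝ) := by
  rcases G.eq_empty_or_nonempty with rfl | ⟨x, hx⟩
  · rw [covNum_empty, Nat.cast_zero, Real.log_zero]
    exact add_nonneg log_covNum_nonneg log_covNum_nonneg
  have hE := hasOpenCover_covNum_dynDist (T := T) hε M E
  have hF := hasOpenCover_covNum_dynDist (T := T) hε N F
  have hE₀ : 0 < covNum (dynDist T dist M) ε E := hE.pos ⟨x, (hG hx).1⟩
  have hF₀ : 0 < covNum (dynDist T dist N) ε F := hF.pos ⟨_, (hG hx).2⟩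
  have hG₀ := (hasOpenCover_covNum_dynDist (T := T) hε (M + N) G).pos ⟨x, hx⟩
  rw [← Real.log_mul (by positivity) (by positivity)]
  refine Real.log_le_log (by exact_mod_cast hG₀) ?_
  exact_mod_cast ((hE.inter_preimage_iterate hF).mono hG).covNum_le

lemma log_covNum_dynDist_mono [CompactSpace X] (hε : 0 < ε) (N : ℕ) (hEF : E ⊆ F) :
    Real.log (covNum (dynDist T dist N) ε E : ℝ) ≤
      Real.log (covNum (dynDist T dist N) ε F : ℝ) := by
  rcases E.eq_empty_or_nonempty with rfl | hE
  · rw [covNum_empty, Nat.cast_zero, Real.log_zero]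
    exact log_covNum_nonneg
  refine Real.log_le_log
    (by exact_mod_cast (hasOpenCover_covNum_dynDist (T := T) hε N E).pos hE) ?_
  exact_mod_cast ((hasOpenCover_covNum_dynDist hε N F).mono hEF).covNum_le

lemma log_covNum_le_supLogCovBall [CompactSpace X] {Y : Type*} (π : X → Y) (ρ : Y → Y → ℝ)
    (hε : 0 < ε) (δ : ℝ) (N : ℕ) (y : Y) :
    Real.log (covNum (dynDist T dist N) ε (π ⁻¹' {x | ρ x y ≤ δ}) : ℝ) ≤
      supLogCovBall π (dynDist T dist N) ρ ε δ := by
  refine le_ciSup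
    (f := fun y => Real.log (covNum (dynDist T dist N) ε (π ⁻¹' {x | ρ x y ≤ δ}) : ℝ)) ?_ y
  refine ⟨Real.log (covNum (dynDist T dist N) ε Set.univ : ℝ), ?_⟩
  rintro _ ⟨z, rfl⟩
  exact log_covNum_dynDist_mono hε N (Set.subset_univ _)

end Covers

lemma supLogCovBall_nonneg {X Y : Type*} (π : X → Y) (ρX : X → X → ℝ) (ρY : Y → Y → ℝ)
    (ε δ : ℝ) : 0 ≤ supLogCovBall π ρX ρY ε δ :=
  Real.iSup_nonneg fun _ => log_covNum_nonneg

/-- for an equivariant continuous map `π : (X, T) → (Y, S)` and fixed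
`ε, δ > 0`, the sequence `a_N = sup_{y ∈ Y} log #(π⁻¹(B_δ(y, d'_N)), d_N, ε)` is
subadditive in `N`, where `B_δ(y, d'_N) = {x ∈ Y : d'_N(x, y) ≤ δ}`. -/
theorem stmt_12 (X Y : Type) [MetricSpace X] [CompactSpace X]
    [MetricSpace Y] [CompactSpace Y] (T : X ≃ₜ X) (S : Y ≃ₜ Y)
    (π : X → Y) (hcont : Continuous π) (hequiv : ∀ x, π (T x) = S (π x))
    (ε δ : ℝ) (hε : 0 < ε) (hδ : 0 < δ) (N₁ N₂ : ℕ) :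
    supLogCovBall π (dynDist (⇑T) dist (N₁ + N₂)) (dynDist (⇑S) dist (N₁ + N₂)) ε δ ≤
      supLogCovBall π (dynDist (⇑T) dist N₁) (dynDist (⇑S) dist N₁) ε δ +
        supLogCovBall π (dynDist (⇑T) dist N₂) (dynDist (⇑S) dist N₂) ε δ := by
  refine Real.iSup_le (fun y => ?_)
    (add_nonneg (supLogCovBall_nonneg _ _ _ _ _) (supLogCovBall_nonneg _ _ _ _ _))
  refine (log_covNum_le_of_subset_inter_preimage_iterate hε
    (E := π ⁻¹' {x | dynDist S dist N₁ x y ≤ δ})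
    (F := π ⁻¹' {x | dynDist S dist N₂ x (S^[N₁] y) ≤ δ}) fun x hx => ⟨?_, ?_⟩).trans
    (add_le_add (log_covNum_le_supLogCovBall π _ hε δ N₁ y)
      (log_covNum_le_supLogCovBall π _ hε δ N₂ (S^[N₁] y)))
  · exact (dynDist_le_add S N₁ N₂ (π x) y).trans hx
  · have hsemi : π (T^[N₁] x) = S^[N₁] (π x) :=
      (Function.Semiconj.iterate_right (f := π) hequiv N₁) x
    change dynDist S dist N₂ (π (T^[N₁] x)) (S^[N₁] y) ≤ δ
    rw [hsemi]
    exact (dynDist_iterate_le_add S N₁ N₂ (π x) y).trans hx
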